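/- arXiv:2106.14110 — 2 statements merged into one kernel-verified Lean document; each statement's English description precedes it below -/
import Mathlib

section
/- Let K, J be positive integers, F, h, c, b real constants with b ≠ 0, and for i ∈ ZMod (K·J) let sector(i) ∈ ZMod K denote the sector containing the i-th fast variable (the image in ZMod K of ⌊i.val / J⌋). Let X : ℝ → (ZMod K → ℝ) and Z : ℝ → (ZMod (K·J) → ℝ) have differentiable components satisfying the full two-scale Lorenz-96 system: Ẋ_k = −X_{k-1}(X_{k-2} − X_{k+1}) − X_k + F − (hc/b)·∑_{i : sector(i)=k} Z_i and Ż_i = −c b Z_{i+1}(Z_{i+2} − Z_{i-1}) − c Z_i + (hc/b)·X_{sector(i)}. Then the total quadratic energy E(t) = (1/2)(∑_k X_k(t)² + ∑_i Z_i(t)²) satisfies dE/dt = −∑_k X_k² + F·∑_k X_k − c·∑_i Z_i²; in particular both the advection terms and the slow–fast coupling terms make no contribution to dE/dt. -/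
/-- The sector (in `ZMod K`) containing the `i`-th fast variable of the
two-scale Lorenz-96 model with `J` fast variables per sector. -/
def lorenz96Sector (K J : ℕ) [NeZero K] [NeZero J] (i : ZMod (K * J)) : ZMod K :=
  ((i.val / J : ℕ) : ZMod K)

/-- The quadratic advection terms of the Lorenz-96 system conserve energy. -/
theorem lorenz96_advection_sum_eq_zero {n : ℕ} [NeZero n] (x : ZMod n → ℝ) :
    ∑ i, x i * (x (i + 1) * (x (i + 2) - x (i - 1))) = 0 := by
  have e : ∑ i, x (i - 1) * x i * x (i + 1) = ∑ i, x i * x (i + 1) * x (i + 2) := by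
    rw [← Equiv.sum_comp (Equiv.addRight (1 : ZMod n))]
    refine Finset.sum_congr rfl fun i _ => ?_
    rw [Equiv.coe_addRight, add_sub_cancel_right, add_assoc, one_add_one_eq_two]
  rw [← sub_eq_zero.mpr e.symm, ← Finset.sum_sub_distrib]
  exact Finset.sum_congr rfl fun i _ => by ring

/-- The advection terms of the slow variables, which run in the opposite direction. -/
theorem lorenz96_advection_sum_eq_zero' {n : ℕ} [NeZero n] (x : ZMod n → ℝ) :
    ∑ i, x i * (x (i - 1) * (x (i - 2) - x (i + 1))) = 0 := by
  rw [← lorenz96_advection_sum_eq_zero fun i => x (-i), ← Equiv.sum_comp (Equiv.neg (ZMod n))]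
  refine Finset.sum_congr rfl fun i _ => ?_
  simp only [Equiv.neg_apply, neg_add, sub_eq_add_neg, neg_neg, add_comm]

/-- The energy received by the slow variables through the coupling is the energy
released by the fast ones. -/
theorem lorenz96_coupling_sum (K J : ℕ) [NeZero K] [NeZero J]
    (x : ZMod K → ℝ) (z : ZMod (K * J) → ℝ) :
    ∑ k, x k * ∑ i ∈ Finset.univ.filter (fun i : ZMod (K * J) => lorenz96Sector K J i = k), z i
      = ∑ i, z i * x (lorenz96Sector K J i) := by
  rw [← Finset.sum_fiberwise Finset.univ (lorenz96Sector K J)]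
  refine Finset.sum_congr rfl fun k _ => ?_
  rw [Finset.mul_sum]
  refine Finset.sum_congr rfl fun i hi => ?_
  rw [(Finset.mem_filter.mp hi).2, mul_comm]

/-- Energy balance for the full two-scale Lorenz-96 system: the total quadratic
energy `E t = (1/2) (∑ k, X t k ^ 2 + ∑ i, Z t i ^ 2)` satisfies
`E' = -∑ k, X k ^ 2 + F * ∑ k, X k - c * ∑ i, Z i ^ 2`; in particular neither
the advection terms nor the slow–fast coupling terms contribute to `E'`. -/
theorem lorenz96_two_scale_energy_balance (K J : ℕ) [NeZero K] [NeZero J]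
    (F h c b : ℝ) (hb : b ≠ 0)
    (X : ℝ → ZMod K → ℝ) (Z : ℝ → ZMod (K * J) → ℝ)
    (hXdiff : ∀ k : ZMod K, Differentiable ℝ fun t => X t k)
    (hZdiff : ∀ i : ZMod (K * J), Differentiable ℝ fun t => Z t i)
    (hXode : ∀ (k : ZMod K) (t : ℝ),
      deriv (fun s => X s k) t
        = -X t (k - 1) * (X t (k - 2) - X t (k + 1)) - X t k + F
          - (h * c / b) *
            ∑ i ∈ Finset.univ.filter (fun i : ZMod (K * J) => lorenz96Sector K J i = k),
              Z t i)
    (hZode : ∀ (i : ZMod (K * J)) (t : ℝ),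
      deriv (fun s => Z s i) t
        = -(c * b) * Z t (i + 1) * (Z t (i + 2) - Z t (i - 1)) - c * Z t i
          + (h * c / b) * X t (lorenz96Sector K J i)) :
    ∀ t : ℝ,
      deriv (fun s => (1 / 2) *
          ((∑ k : ZMod K, X s k ^ 2) + ∑ i : ZMod (K * J), Z s i ^ 2)) t
        = -(∑ k : ZMod K, X t k ^ 2) + F * (∑ k : ZMod K, X t k)
          - c * ∑ i : ZMod (K * J), Z t i ^ 2 := by
  intro t
  have hX : HasDerivAt (fun s => ∑ k, X s k ^ 2)
      (∑ k, 2 * (X t k * deriv (fun s => X s k) t)) t :=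
    HasDerivAt.fun_sum fun k _ => by
      simpa [mul_assoc] using (hXdiff k t).hasDerivAt.fun_pow 2
  have hZ : HasDerivAt (fun s => ∑ i, Z s i ^ 2)
      (∑ i, 2 * (Z t i * deriv (fun s => Z s i) t)) t :=
    HasDerivAt.fun_sum fun i _ => by
      simpa [mul_assoc] using (hZdiff i t).hasDerivAt.fun_pow 2
  rw [((hX.fun_add hZ).const_mul (1 / 2)).deriv, ← Finset.mul_sum, ← Finset.mul_sum]
  have hXsum : ∑ k, X t k * deriv (fun s => X s k) t
      = -(∑ k, X t k * (X t (k - 1) * (X t (k - 2) - X t (k + 1)))) - ∑ k, X t k ^ 2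
        + F * ∑ k, X t k
        - (h * c / b) * ∑ k, X t k * ∑ i ∈ Finset.univ.filter
            (fun i : ZMod (K * J) => lorenz96Sector K J i = k), Z t i := by
    rw [Finset.mul_sum, Finset.mul_sum, ← Finset.sum_neg_distrib, ← Finset.sum_sub_distrib,
      ← Finset.sum_add_distrib, ← Finset.sum_sub_distrib]
    exact Finset.sum_congr rfl fun k _ => by rw [hXode]; ring
  have hZsum : ∑ i, Z t i * deriv (fun s => Z s i) t
      = -(c * b) * (∑ i, Z t i * (Z t (i + 1) * (Z t (i + 2) - Z t (i - 1))))
        - c * ∑ i, Z t i ^ 2 + (h * c / b) * ∑ i, Z t i * X t (lorenz96Sector K J i) := by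
    rw [Finset.mul_sum, Finset.mul_sum, Finset.mul_sum, ← Finset.sum_sub_distrib,
      ← Finset.sum_add_distrib]
    exact Finset.sum_congr rfl fun i _ => by rw [hZode]; ring
  rw [hXsum, hZsum, lorenz96_advection_sum_eq_zero', lorenz96_advection_sum_eq_zero,
    lorenz96_coupling_sum]
  ring
end

section
/- For all natural numbers k, m, n with 2k ≤ m ≤ n, there exists an m × n real matrix Θ such that every family of at most 2k columns of Θ is linearly independent; consequently there exists a sensing matrix with m rows permitting exact recovery of every k-sparse vector in ℝ^n whenever m ≥ 2k. -/
/-- Truncated moment vectors `(1, v j, …, v j ^ (m - 1))` at distinct nodes `v j` are linearly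
independent as soon as there are at most `m` nodes. -/
theorem linearIndependent_pow_of_card_le {ι R : Type*} [Fintype ι] [CommRing R] [IsDomain R]
    {v : ι → R} (hv : Function.Injective v) {m : ℕ} (hm : Fintype.card ι ≤ m) :
    LinearIndependent R (fun j : ι => fun i : Fin m => v j ^ (i : ℕ)) := by
  rw [Fintype.linearIndependent_iff]
  intro g hg j
  let e := Fintype.equivFin ι
  have hzero : g ∘ e.symm = 0 := by
    refine Matrix.eq_zero_of_forall_pow_sum_mul_pow_eq_zero (f := v ∘ e.symm)
      (hv.comp e.symm.injective) fun i => ?_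
    have hi := congrFun hg (Fin.castLE hm i)
    simp only [Finset.sum_apply, Pi.smul_apply, smul_eq_mul, Fin.val_castLE, Pi.zero_apply] at hi
    rw [← hi]
    exact e.symm.sum_comp fun j => g j * v j ^ (i : ℕ)
  simpa using congrFun hzero (e j)

/-- For all `k, m, n` with `2k ≤ m ≤ n` there is an `m × n` real sensing matrix
every `2k` of whose columns are linearly independent; such a matrix permits
exact recovery of every `k`-sparse vector in `ℝⁿ`. -/
theorem exists_sensing_matrix (k m n : ℕ) (hkm : 2 * k ≤ m) (hmn : m ≤ n) :
    ∃ Θ : Matrix (Fin m) (Fin n) ℝ,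
      ∀ S : Finset (Fin n), S.card ≤ 2 * k →
        LinearIndependent ℝ (fun j : S => fun i : Fin m => Θ i (j : Fin n)) := by
  refine ⟨Matrix.of fun i j => ((j : ℕ) : ℝ) ^ (i : ℕ), fun S hS => ?_⟩
  exact linearIndependent_pow_of_card_le (v := fun j : S => (((j : Fin n) : ℕ) : ℝ))
    (Nat.cast_injective.comp (Fin.val_injective.comp Subtype.val_injective))
    (by simpa using hS.trans hkm)
end
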